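/- There exists a constant C > 0, independent of Φ, α, n and f, such that for every Φ > 0, every α > 1, every nonzero integer n, every continuous f on (0,1) with ∫₀¹|f|²·r dr < ∞, and every smooth solution ψ of the n-th mode problem with slip boundary conditions, the following four estimates hold: (i) ∫₀¹ |(d/dr)(r·ψ)|²·(1/r) dr + n²·∫₀¹ |ψ|²·r dr ≤ C·(Φ·|n|)^{−5/3}·∫₀¹ |f|²·r dr; (ii) ∫₀¹ |𝓛ψ|²·r dr + n²·∫₀¹ |(d/dr)(r·ψ)|²·(1/r) dr + n⁴·∫₀¹ |ψ|²·r dr ≤ C·(Φ·|n|)^{−4/3}·∫₀¹ |f|²·r dr; (iii) ∫₀¹ |(d/dr)(r·𝓛ψ)|²·(1/r) dr + n²·∫₀¹ |𝓛ψ|²·r dr + n⁴·∫₀¹ |(d/dr)(r·ψ)|²·(1/r) dr + n⁶·∫₀¹ |ψ|²·r dr ≤ C·(Φ·|n|)^{−2/3}·∫₀¹ |f|²·r dr; (iv) |ψ'(1)| ≤ C·(Φ·|n|)^{−3/4}·(∫₀¹ |f|²·r dr)^{1/2}. (Lemma 3.6 (propslip-large): refined a priori estimates for the slip problem when the slip coefficient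 is large.) -/

import Mathlib

open MeasureTheory Filter

/-- One-sided derivative on `(0,1]`. -/
noncomputable def dz (g : ℝ → ℂ) : ℝ → ℂ := derivWithin g (Set.Ioc 0 1)

/-- The operator `(𝓛 g)(r) = g''(r) + (1/r) g'(r) − (1/r²) g(r)`. -/
noncomputable def Lop (g : ℝ → ℂ) : ℝ → ℂ := fun r =>
  dz (dz g) r + ((r : ℂ))⁻¹ * dz g r - (((r : ℂ)) ^ 2)⁻¹ * g r

/-- Weighted integral over `(0,1)` with values in `[0,∞]`. -/
noncomputable def wInt (h : ℝ → ℝ) : ENNReal :=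
  ∫⁻ r in Set.Ioo (0 : ℝ) 1, ENNReal.ofReal (h r)

/-- The Poiseuille profile `Ū(r) = ((4+2α)/(4+α)) (1 − (2α/(4+2α)) r²) (Φ/π)`. -/
noncomputable def Ubar (Φ α : ℝ) : ℝ → ℝ := fun r =>
  (4 + 2 * α) / (4 + α) * (1 - 2 * α / (4 + 2 * α) * r ^ 2) * (Φ / Real.pi)

/-- A smooth solution of the `n`-th mode problem with slip boundary conditions:
`ψ` is four times continuously differentiable on `(0,1]`; `ψ`, `ψ'`, `𝓛ψ` and
`(d/dr)(r 𝓛ψ)` extend continuously to `[0,1]`;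
`i n Ū (𝓛−n²)ψ − (𝓛−n²)²ψ = f` on `(0,1)`; `ψ(0) = ψ(1) = (𝓛ψ)(0) = 0` and
`(𝓛ψ)(1) = 0`; and the relevant weighted integrals are finite. -/
structure SlipSol (Φ α : ℝ) (n : ℤ) (f ψ : ℝ → ℂ) : Prop where
  smooth : ContDiffOn ℝ 4 ψ (Set.Ioc 0 1)
  /-- `ψ` extends continuously to `[0,1]` with `ψ(0) = 0`. -/
  ext_psi : Filter.Tendsto ψ (nhdsWithin (0 : ℝ) (Set.Ioc 0 1)) (nhds (0 : ℂ))
  /-- `ψ'` extends continuously to `[0,1]`. -/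
  ext_dpsi : ∃ L : ℂ, Filter.Tendsto (dz ψ) (nhdsWithin (0 : ℝ) (Set.Ioc 0 1)) (nhds L)
  /-- `𝓛ψ` extends continuously to `[0,1]` with `(𝓛ψ)(0) = 0`. -/
  ext_Lpsi : Filter.Tendsto (Lop ψ) (nhdsWithin (0 : ℝ) (Set.Ioc 0 1)) (nhds (0 : ℂ))
  /-- `(d/dr)(r 𝓛ψ)` extends continuously to `[0,1]`. -/
  ext_dLpsi : ∃ L : ℂ, Filter.Tendsto (dz (fun r => (r : ℂ) * Lop ψ r))
    (nhdsWithin (0 : ℝ) (Set.Ioc 0 1)) (nhds L)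
  bc_psi : ψ 1 = 0
  bc_slip : Lop ψ 1 = 0
  eqn : ∀ r ∈ Set.Ioo (0 : ℝ) 1,
    Complex.I * (n : ℂ) * (Ubar Φ α r : ℂ) * (Lop ψ r - (n : ℂ) ^ 2 * ψ r)
      - (Lop (fun s => Lop ψ s - (n : ℂ) ^ 2 * ψ s) r
          - (n : ℂ) ^ 2 * (Lop ψ r - (n : ℂ) ^ 2 * ψ r)) = f r
  fin_psi : wInt (fun r => ‖ψ r‖ ^ 2 * r) < ⊤
  fin_dpsi : wInt (fun r => ‖dz (fun s => (s : ℂ) * ψ s) r‖ ^ 2 / r) < ⊤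
  fin_Lpsi : wInt (fun r => ‖Lop ψ r‖ ^ 2 * r) < ⊤
  fin_dLpsi : wInt (fun r => ‖dz (fun s => (s : ℂ) * Lop ψ s) r‖ ^ 2 / r) < ⊤
  fin_LLpsi : wInt (fun r => ‖Lop (Lop ψ) r‖ ^ 2 * r) < ⊤

/-! ### Generic lemmas on `(0,1)` -/

lemma bdd_of_lim {g : ℝ → ℂ} (hc : ContinuousOn g (Set.Ioo 0 1)) {a b : ℂ}
    (ha : Tendsto g (nhdsWithin 0 (Set.Ioi 0)) (nhds a))
    (hb : Tendsto g (nhdsWithin 1 (Set.Iio 1)) (nhds b)) :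
    ∃ B : ℝ, 0 ≤ B ∧ ∀ r ∈ Set.Ioo (0 : ℝ) 1, ‖g r‖ ≤ B := by
  have h := continuousOn_Icc_extendFrom_Ioo hc ha hb
  obtain ⟨B, hB⟩ := isCompact_Icc.exists_bound_of_continuousOn h
  refine ⟨max B 0, le_max_right _ _, fun r hr => ?_⟩
  have h1 := hB r ⟨hr.1.le, hr.2.le⟩
  have h2 : extendFrom (Set.Ioo 0 1) g r = g r :=
    extendFrom_extends hc r hr
  rw [h2] at h1
  exact h1.trans (le_max_left _ _)

lemma intOn_of_le {E : Type*} [NormedAddCommGroup E] {f : ℝ → E} {g : ℝ → ℝ}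
    (hc : ContinuousOn f (Set.Ioo 0 1))
    (hg : IntegrableOn g (Set.Ioo 0 1)) (h : ∀ r ∈ Set.Ioo (0 : ℝ) 1, ‖f r‖ ≤ g r) :
    IntegrableOn f (Set.Ioo 0 1) := by
  refine Integrable.mono' hg (hc.aestronglyMeasurable measurableSet_Ioo) ?_
  exact (ae_restrict_iff' measurableSet_Ioo).2 (Eventually.of_forall h)

lemma intOn_of_bdd {E : Type*} [NormedAddCommGroup E] {f : ℝ → E} {B : ℝ}
    (hc : ContinuousOn f (Set.Ioo 0 1))
    (h : ∀ r ∈ Set.Ioo (0 : ℝ) 1, ‖f r‖ ≤ B) :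
    IntegrableOn f (Set.Ioo 0 1) := by
  refine intOn_of_le hc (g := fun _ => B) ?_ h
  exact integrableOn_const (by simp) (by simp)

lemma ftc_eq {F F' : ℝ → ℂ} {a b : ℂ}
    (hd : ∀ r ∈ Set.Ioo (0 : ℝ) 1, HasDerivAt F (F' r) r)
    (hi : IntegrableOn F' (Set.Ioo 0 1))
    (ha : Tendsto F (nhdsWithin 0 (Set.Ioi 0)) (nhds a))
    (hb : Tendsto F (nhdsWithin 1 (Set.Iio 1)) (nhds b)) :
    ∫ r in Set.Ioo (0 : ℝ) 1, F' r = b - a := by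
  have := intervalIntegral.integral_eq_sub_of_hasDerivAt_of_tendsto (zero_lt_one) hd
    ((intervalIntegrable_iff_integrableOn_Ioo_of_le zero_le_one).2 hi) ha hb
  rw [← this, intervalIntegral.integral_of_le zero_le_one, integral_Ioc_eq_integral_Ioo]

lemma ftc_le {F F' Q : ℝ → ℝ} {a b : ℝ}
    (hd : ∀ r ∈ Set.Ioo (0 : ℝ) 1, HasDerivAt F (F' r) r)
    (hi : IntegrableOn Q (Set.Ioo 0 1))
    (hle : ∀ r ∈ Set.Ioo (0 : ℝ) 1, F' r ≤ Q r)
    (ha : Tendsto F (nhdsWithin 0 (Set.Ioi 0)) (nhds a))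
    (hb : Tendsto F (nhdsWithin 1 (Set.Iio 1)) (nhds b)) :
    b - a ≤ ∫ r in Set.Ioo (0 : ℝ) 1, Q r := by
  have hc : ContinuousOn F (Set.Ioo 0 1) := fun r hr => (hd r hr).continuousAt.continuousWithinAt
  have h := continuousOn_Icc_extendFrom_Ioo hc ha hb
  have h0 := eq_lim_at_left_extendFrom_Ioo zero_lt_one ha
  have h1 := eq_lim_at_right_extendFrom_Ioo zero_lt_one hb
  have key := intervalIntegral.sub_le_integral_of_hasDeriv_right_of_le
    (g := extendFrom (Set.Ioo 0 1) F) (g' := F') (φ := Q) (zero_le_one) h ?_ ?_ hle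
  · rw [h0, h1, intervalIntegral.integral_of_le zero_le_one, integral_Ioc_eq_integral_Ioo] at key
    exact key
  · intro r hr
    refine ((hd r hr).congr_of_eventuallyEq ?_).hasDerivWithinAt
    filter_upwards [isOpen_Ioo.mem_nhds hr] with x hx
    exact extendFrom_extends hc x hx
  · rw [integrableOn_Icc_iff_integrableOn_Ioo]; exact hi

lemma intAdd {E : Type*} [NormedAddCommGroup E] {f g : ℝ → E}
    (hf : IntegrableOn f (Set.Ioo 0 1)) (hg : IntegrableOn g (Set.Ioo 0 1)) :
    IntegrableOn (fun r => f r + g r) (Set.Ioo 0 1) := Integrable.add hf hg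

lemma intSub {E : Type*} [NormedAddCommGroup E] {f g : ℝ → E}
    (hf : IntegrableOn f (Set.Ioo 0 1)) (hg : IntegrableOn g (Set.Ioo 0 1)) :
    IntegrableOn (fun r => f r - g r) (Set.Ioo 0 1) := Integrable.sub hf hg

lemma intMul {f : ℝ → ℝ} (hf : IntegrableOn f (Set.Ioo 0 1)) (c : ℝ) :
    IntegrableOn (fun r => c * f r) (Set.Ioo 0 1) := Integrable.const_mul hf c

lemma cs_ineq {p q t : ℝ → ℝ} (hp : IntegrableOn p (Set.Ioo 0 1))
    (hq : IntegrableOn q (Set.Ioo 0 1)) (ht : IntegrableOn t (Set.Ioo 0 1))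
    (hp0 : ∀ r ∈ Set.Ioo (0 : ℝ) 1, 0 ≤ p r) (hq0 : ∀ r ∈ Set.Ioo (0 : ℝ) 1, 0 ≤ q r)
    (h : ∀ r ∈ Set.Ioo (0 : ℝ) 1, t r ^ 2 ≤ p r * q r) :
    (∫ r in Set.Ioo (0 : ℝ) 1, t r) ^ 2 ≤
      (∫ r in Set.Ioo (0 : ℝ) 1, p r) * ∫ r in Set.Ioo (0 : ℝ) 1, q r := by
  have key : ∀ s : ℝ, 0 ≤ (∫ r in Set.Ioo (0 : ℝ) 1, q r) * (s * s)
      + (-2 * ∫ r in Set.Ioo (0 : ℝ) 1, t r) * s + ∫ r in Set.Ioo (0 : ℝ) 1, p r := by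
    intro s
    have h1 : 0 ≤ ∫ r in Set.Ioo (0 : ℝ) 1, ((s * s) * q r + (-2 * s) * t r + p r) := by
      refine setIntegral_nonneg measurableSet_Ioo fun r hr => ?_
      have a1 := hp0 r hr
      have a2 := hq0 r hr
      have a3 := h r hr
      have a4 : |2 * s * t r| ≤ |p r + s * s * q r| := by
        apply sq_le_sq.1
        nlinarith [sq_nonneg (p r - s * s * q r), mul_le_mul_of_nonneg_left a3 (sq_nonneg s)]
      rw [abs_of_nonneg (show 0 ≤ p r + s * s * q r by nlinarith [mul_nonneg (mul_self_nonneg s) a2])] at a4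
      linarith [le_abs_self (2 * s * t r)]
    rw [integral_add (intAdd (hq.const_mul _) (ht.const_mul _)) hp,
      integral_add (hq.const_mul _) (ht.const_mul _), integral_const_mul, integral_const_mul] at h1
    linarith
  have := discrim_le_zero key
  unfold discrim at this
  nlinarith

/-- A radial triple: `G = (r g)'`, `h = (G / r)' = 𝓛 g`, with boundary data. -/
structure Rad (g G h : ℝ → ℂ) : Prop where
  d1 : ∀ r ∈ Set.Ioo (0 : ℝ) 1, HasDerivAt (fun s : ℝ => (s : ℂ) * g s) (G r) r
  d2 : ∀ r ∈ Set.Ioo (0 : ℝ) 1, HasDerivAt (fun s : ℝ => (s : ℂ)⁻¹ * G s) (h r) r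
  cg : ContinuousOn g (Set.Ioo 0 1)
  cG : ContinuousOn G (Set.Ioo 0 1)
  ch : ContinuousOn h (Set.Ioo 0 1)
  g0 : Tendsto g (nhdsWithin 0 (Set.Ioi 0)) (nhds 0)
  g1 : Tendsto g (nhdsWithin 1 (Set.Iio 1)) (nhds 0)
  G0 : ∃ L, Tendsto G (nhdsWithin 0 (Set.Ioi 0)) (nhds L)
  G1 : ∃ L, Tendsto G (nhdsWithin 1 (Set.Iio 1)) (nhds L)
  iG : IntegrableOn (fun r => ‖G r‖ ^ 2 / r) (Set.Ioo 0 1)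
  ih : IntegrableOn (fun r => ‖h r‖ ^ 2 * r) (Set.Ioo 0 1)

lemma norm_sub_sq_le (x y : ℂ) : ‖x - y‖ ^ 2 ≤ 2 * ‖x‖ ^ 2 + 2 * ‖y‖ ^ 2 := by
  have := norm_sub_le x y
  nlinarith [norm_nonneg (x - y), norm_nonneg x, norm_nonneg y, sq_nonneg (‖x‖ - ‖y‖)]

lemma Rad.comb {a A a2 b B b2 : ℝ → ℂ} (ha : Rad a A a2) (hb : Rad b B b2) (c : ℂ) :
    Rad (fun r => a r - c * b r) (fun r => A r - c * B r) (fun r => a2 r - c * b2 r) where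
  d1 r hr := by
    have := (ha.d1 r hr).sub ((hb.d1 r hr).const_mul c)
    refine this.congr_of_eventuallyEq (Eventually.of_forall fun s => ?_)
    simp only [Pi.sub_apply]; ring
  d2 r hr := by
    have := (ha.d2 r hr).sub ((hb.d2 r hr).const_mul c)
    refine this.congr_of_eventuallyEq (Eventually.of_forall fun s => ?_)
    simp only [Pi.sub_apply]; ring
  cg := ha.cg.sub (continuousOn_const.mul hb.cg)
  cG := ha.cG.sub (continuousOn_const.mul hb.cG)
  ch := ha.ch.sub (continuousOn_const.mul hb.ch)
  g0 := by simpa using ha.g0.sub (hb.g0.const_mul c)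
  g1 := by simpa using ha.g1.sub (hb.g1.const_mul c)
  G0 := by
    obtain ⟨x, hx⟩ := ha.G0
    obtain ⟨y, hy⟩ := hb.G0
    exact ⟨_, hx.sub (hy.const_mul c)⟩
  G1 := by
    obtain ⟨x, hx⟩ := ha.G1
    obtain ⟨y, hy⟩ := hb.G1
    exact ⟨_, hx.sub (hy.const_mul c)⟩
  iG := by
    refine intOn_of_le (g := fun r => 2 * (‖A r‖ ^ 2 / r) + 2 * ‖c‖ ^ 2 * (‖B r‖ ^ 2 / r)) ?_
      (intAdd (intMul ha.iG _) (intMul hb.iG _)) ?_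
    · exact ((ha.cG.sub (continuousOn_const.mul hb.cG)).norm.pow 2).div continuousOn_id
        (fun r hr => hr.1.ne')
    · intro r hr
      have h1 := norm_sub_sq_le (A r) (c * B r)
      rw [norm_mul, mul_pow] at h1
      have hr0 : 0 < r := hr.1
      rw [Real.norm_of_nonneg (by positivity)]
      calc _ ≤ (2 * ‖A r‖ ^ 2 + 2 * (‖c‖ ^ 2 * ‖B r‖ ^ 2)) / r := by gcongr
        _ = _ := by ring
  ih := by
    refine intOn_of_le (g := fun r => 2 * (‖a2 r‖ ^ 2 * r) + 2 * ‖c‖ ^ 2 * (‖b2 r‖ ^ 2 * r)) ?_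
      (intAdd (intMul ha.ih _) (intMul hb.ih _)) ?_
    · exact ((ha.ch.sub (continuousOn_const.mul hb.ch)).norm.pow 2).mul continuousOn_id
    · intro r hr
      have h1 := norm_sub_sq_le (a2 r) (c * b2 r)
      rw [norm_mul, mul_pow] at h1
      have hr0 : 0 < r := hr.1
      rw [Real.norm_of_nonneg (by positivity)]
      calc _ ≤ (2 * ‖a2 r‖ ^ 2 + 2 * (‖c‖ ^ 2 * ‖b2 r‖ ^ 2)) * r := by gcongr
        _ = _ := by ring

lemma Rad.bg {g G h : ℝ → ℂ} (H : Rad g G h) :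
    ∃ B : ℝ, 0 ≤ B ∧ ∀ r ∈ Set.Ioo (0 : ℝ) 1, ‖g r‖ ≤ B := bdd_of_lim H.cg H.g0 H.g1

lemma Rad.bG {g G h : ℝ → ℂ} (H : Rad g G h) :
    ∃ B : ℝ, 0 ≤ B ∧ ∀ r ∈ Set.Ioo (0 : ℝ) 1, ‖G r‖ ≤ B := by
  obtain ⟨x, hx⟩ := H.G0
  obtain ⟨y, hy⟩ := H.G1
  exact bdd_of_lim H.cG hx hy

lemma Rad.ig {g G h : ℝ → ℂ} (H : Rad g G h) :
    IntegrableOn (fun r => ‖g r‖ ^ 2 * r) (Set.Ioo 0 1) := by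
  obtain ⟨B, hB0, hB⟩ := H.bg
  refine intOn_of_bdd (B := B ^ 2 * 1) ((H.cg.norm.pow 2).mul continuousOn_id) fun r hr => ?_
  have hr0 : 0 < r := hr.1
  rw [Real.norm_of_nonneg (by positivity)]
  have := hB r hr
  have := hr.2.le
  gcongr

lemma Rad.ibp_int {a A a2 b B b2 : ℝ → ℂ} (ha : Rad a A a2) (hb : Rad b B b2) :
    IntegrableOn (fun r : ℝ => (r : ℂ) * a2 r * (starRingEnd ℂ) (b r)) (Set.Ioo 0 1) ∧
    IntegrableOn (fun r : ℝ => (r : ℂ)⁻¹ * A r * (starRingEnd ℂ) (B r)) (Set.Ioo 0 1) := by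
  constructor
  · refine intOn_of_le (g := fun r => ‖a2 r‖ ^ 2 * r + ‖b r‖ ^ 2 * r) ?_ (intAdd ha.ih hb.ig) ?_
    · exact (Complex.continuous_ofReal.continuousOn.mul ha.ch).mul
        (Complex.continuous_conj.comp_continuousOn hb.cg)
    · intro r hr
      have hr0 : 0 < r := hr.1
      rw [norm_mul, norm_mul, RCLike.norm_conj, Complex.norm_real, Real.norm_of_nonneg hr0.le]
      nlinarith [mul_nonneg hr0.le (sq_nonneg (‖a2 r‖ - ‖b r‖)),
        mul_nonneg hr0.le (sq_nonneg (‖a2 r‖ + ‖b r‖))]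
  · refine intOn_of_le (g := fun r => ‖A r‖ ^ 2 / r + ‖B r‖ ^ 2 / r) ?_ (intAdd ha.iG hb.iG) ?_
    · refine ((Complex.continuous_ofReal.continuousOn.inv₀ ?_).mul ha.cG).mul
        (Complex.continuous_conj.comp_continuousOn hb.cG)
      intro r hr
      exact_mod_cast hr.1.ne'
    · intro r hr
      have hr0 : 0 < r := hr.1
      have hr1 : 0 < r⁻¹ := by positivity
      rw [norm_mul, norm_mul, RCLike.norm_conj, norm_inv, Complex.norm_real,
        Real.norm_of_nonneg hr0.le, div_eq_mul_inv, div_eq_mul_inv]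
      nlinarith [mul_nonneg hr1.le (sq_nonneg (‖A r‖ - ‖B r‖)),
        mul_nonneg hr1.le (sq_nonneg (‖A r‖ + ‖B r‖))]

lemma Rad.ibp {a A a2 b B b2 : ℝ → ℂ} (ha : Rad a A a2) (hb : Rad b B b2) :
    ∫ r in Set.Ioo (0 : ℝ) 1, (r : ℂ) * a2 r * (starRingEnd ℂ) (b r) =
      - ∫ r in Set.Ioo (0 : ℝ) 1, (r : ℂ)⁻¹ * A r * (starRingEnd ℂ) (B r) := by
  obtain ⟨i1, i2⟩ := ha.ibp_int hb
  have key := ftc_eq (F := fun r : ℝ => ((r : ℂ)⁻¹ * A r) * (starRingEnd ℂ) ((r : ℂ) * b r))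
    (F' := fun r : ℝ => (r : ℂ) * a2 r * (starRingEnd ℂ) (b r) +
      (r : ℂ)⁻¹ * A r * (starRingEnd ℂ) (B r)) (a := 0) (b := 0) ?_ (intAdd i1 i2) ?_ ?_
  · rw [integral_add i1 i2] at key
    linear_combination key
  · intro r hr
    have := (ha.d2 r hr).mul (hb.d1 r hr).star
    refine this.congr_deriv ?_
    have : (r : ℂ) ≠ 0 := by exact_mod_cast (ne_of_gt hr.1)
    simp only [RCLike.star_def, map_mul, Complex.conj_ofReal]
    ring
  · obtain ⟨x, hx⟩ := ha.G0
    have h2 := hx.mul ((Complex.continuous_conj.tendsto 0).comp hb.g0)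
    rw [map_zero, mul_zero] at h2
    refine h2.congr' ?_
    filter_upwards [self_mem_nhdsWithin] with r hr
    have : (r : ℂ) ≠ 0 := by exact_mod_cast (ne_of_gt hr)
    simp only [Function.comp, map_mul, Complex.conj_ofReal]
    field_simp
  · obtain ⟨x, hx⟩ := ha.G1
    have h2 := hx.mul ((Complex.continuous_conj.tendsto 0).comp hb.g1)
    rw [map_zero, mul_zero] at h2
    refine h2.congr' ?_
    filter_upwards [Ioo_mem_nhdsLT (zero_lt_one)] with r hr
    have : (r : ℂ) ≠ 0 := by exact_mod_cast (ne_of_gt hr.1)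
    simp only [Function.comp, map_mul, Complex.conj_ofReal]
    field_simp

lemma Rad.lip {g G h : ℝ → ℂ} (H : Rad g G h) :
    ∃ B : ℝ, 0 ≤ B ∧ ∀ r ∈ Set.Ioo (0 : ℝ) 1, ‖g r‖ ≤ B * (1 - r) := by
  obtain ⟨M, hM0, hM⟩ := H.bg
  obtain ⟨B, hB0, hB⟩ := H.bG
  have hu : ∀ r ∈ Set.Ioo (0 : ℝ) 1, ‖(r : ℂ) * g r‖ ≤ B * (1 - r) := by
    intro r hr
    have h1 : ∀ s ∈ Set.Ioo r 1, ‖(s : ℂ) * g s - (r : ℂ) * g r‖ ≤ B * (s - r) := by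
      intro s hs
      have := (convex_Ioo (0 : ℝ) 1).norm_image_sub_le_of_norm_hasDerivWithin_le
        (f := fun s : ℝ => (s : ℂ) * g s) (f' := G) (C := B) (x := r) (y := s)
        (fun x hx => (H.d1 x hx).hasDerivWithinAt) hB hr ⟨hr.1.trans hs.1, hs.2⟩
      rwa [Real.norm_of_nonneg (by linarith [hs.1])] at this
    have h2 : Tendsto (fun s : ℝ => ‖(s : ℂ) * g s - (r : ℂ) * g r‖)
        (nhdsWithin 1 (Set.Iio 1)) (nhds ‖((1 : ℝ) : ℂ) * 0 - (r : ℂ) * g r‖) := by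
      refine Tendsto.norm (Tendsto.sub_const (Tendsto.mul ?_ H.g1) _)
      exact (Complex.continuous_ofReal.tendsto 1).mono_left nhdsWithin_le_nhds
    have h3 : Tendsto (fun s : ℝ => B * (s - r))
        (nhdsWithin 1 (Set.Iio 1)) (nhds (B * (1 - r))) := by
      refine Tendsto.mono_left ?_ nhdsWithin_le_nhds
      exact (continuous_const.mul (continuous_id.sub continuous_const)).tendsto 1
    have h4 := le_of_tendsto_of_tendsto h2 h3 (by
      filter_upwards [Ioo_mem_nhdsLT hr.2] with s hs using h1 s hs)
    simpa using h4
  refine ⟨2 * B + 2 * M, by positivity, fun r hr => ?_⟩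
  have h1 := hu r hr
  have h2 := hM r hr
  have hr0 := hr.1
  have hr1 := hr.2
  rw [norm_mul, Complex.norm_real, Real.norm_of_nonneg hr0.le] at h1
  by_cases h : r ≤ 1 / 2
  · nlinarith [mul_nonneg hB0 (sub_nonneg.2 hr1.le)]
  · push Not at h
    nlinarith [mul_nonneg hM0 (sub_nonneg.2 hr1.le), norm_nonneg (g r)]

lemma Rad.iH {g G h : ℝ → ℂ} (H : Rad g G h) :
    IntegrableOn (fun r => ‖g r‖ ^ 2 * r / (1 - r ^ 2) ^ 2) (Set.Ioo 0 1) := by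
  obtain ⟨B, hB0, hB⟩ := H.lip
  refine intOn_of_bdd (B := B ^ 2) ?_ fun r hr => ?_
  · refine ContinuousOn.div ((H.cg.norm.pow 2).mul continuousOn_id) (by fun_prop) ?_
    intro r hr
    have : 0 < 1 - r ^ 2 := by nlinarith [hr.1, hr.2]
    positivity
  · have hr0 := hr.1
    have hr1 := hr.2
    have h1 : 0 < 1 - r ^ 2 := by nlinarith
    have h2 := hB r hr
    rw [Real.norm_of_nonneg (by positivity), div_le_iff₀ (by positivity)]
    have h3 : ‖g r‖ ≤ B * (1 - r ^ 2) := h2.trans (by gcongr; nlinarith)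
    have h4 : ‖g r‖ ^ 2 ≤ (B * (1 - r ^ 2)) ^ 2 := by gcongr
    nlinarith [sq_nonneg ‖g r‖]

lemma Rad.hardy {g G h : ℝ → ℂ} (H : Rad g G h) :
    ∫ r in Set.Ioo (0 : ℝ) 1, ‖g r‖ ^ 2 * r / (1 - r ^ 2) ^ 2 ≤
      ∫ r in Set.Ioo (0 : ℝ) 1, ‖G r‖ ^ 2 / r := by
  have key := ftc_le (F := fun r : ℝ => ‖(r : ℂ) * g r‖ ^ 2 * (2 / r ^ 2 - 1 / (1 - r ^ 2)))
    (F' := fun r : ℝ => 2 * inner ℝ ((r : ℂ) * g r) (G r) * (2 / r ^ 2 - 1 / (1 - r ^ 2))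
      + ‖(r : ℂ) * g r‖ ^ 2 * (-4 / r ^ 3 - 2 * r / (1 - r ^ 2) ^ 2))
    (Q := fun r => ‖G r‖ ^ 2 / r - ‖g r‖ ^ 2 * r / (1 - r ^ 2) ^ 2)
    (a := 0) (b := 0) ?_ (intSub H.iG H.iH) ?_ ?_ ?_
  · rw [integral_sub H.iG H.iH] at key
    linarith
  · intro r hr
    have hr0 := hr.1
    have h1 : 0 < 1 - r ^ 2 := by nlinarith [hr.2]
    refine (H.d1 r hr).norm_sq.mul ?_
    have e1 : HasDerivAt (fun r : ℝ => 2 / r ^ 2) (-4 / r ^ 3) r := by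
      have := (hasDerivAt_const r (2 : ℝ)).div (hasDerivAt_pow 2 r) (by positivity)
      refine this.congr_deriv ?_
      field_simp
      norm_num
      ring
    have e2 : HasDerivAt (fun r : ℝ => 1 / (1 - r ^ 2)) (2 * r / (1 - r ^ 2) ^ 2) r := by
      have := (hasDerivAt_const r (1 : ℝ)).div ((hasDerivAt_pow 2 r).const_sub 1) h1.ne'
      refine this.congr_deriv ?_
      norm_num
    exact e1.sub e2
  · intro r hr
    have hr0 := hr.1
    have h1 : 0 < 1 - r ^ 2 := by nlinarith [hr.2]
    set X := (r : ℂ) * g r with hX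
    have hn : ‖X‖ ^ 2 = r ^ 2 * ‖g r‖ ^ 2 := by
      rw [hX, norm_mul, Complex.norm_real, Real.norm_of_nonneg hr0.le, mul_pow]
    set k := 2 / r - r / (1 - r ^ 2) with hk
    have sq := sq_nonneg ‖G r - k • X‖
    rw [norm_sub_sq_real, inner_smul_right, norm_smul, mul_pow, Real.norm_eq_abs, sq_abs,
      real_inner_comm] at sq
    have hg2 : ‖g r‖ ^ 2 = ‖X‖ ^ 2 / r ^ 2 := by rw [hn]; field_simp
    have sq2 : 0 ≤ (‖G r‖ ^ 2 - 2 * (k * inner ℝ X (G r)) + k ^ 2 * ‖X‖ ^ 2) / r :=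
      div_nonneg sq hr0.le
    have e : ‖G r‖ ^ 2 / r - ‖g r‖ ^ 2 * r / (1 - r ^ 2) ^ 2
        - (2 * inner ℝ X (G r) * (2 / r ^ 2 - 1 / (1 - r ^ 2))
      + ‖X‖ ^ 2 * (-4 / r ^ 3 - 2 * r / (1 - r ^ 2) ^ 2)) =
      (‖G r‖ ^ 2 - 2 * (k * inner ℝ X (G r)) + k ^ 2 * ‖X‖ ^ 2) / r
       + ‖X‖ ^ 2 * (3 / (r * (1 - r ^ 2))) := by
      rw [hg2, hk]
      field_simp
      ring
    have : 0 ≤ ‖X‖ ^ 2 * (3 / (r * (1 - r ^ 2))) := by positivity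
    linarith
  · have h2 : Tendsto (fun r : ℝ => ‖g r‖ ^ 2 * (2 - r ^ 2 / (1 - r ^ 2)))
        (nhdsWithin 0 (Set.Ioi 0)) (nhds (‖(0 : ℂ)‖ ^ 2 * (2 - 0 ^ 2 / (1 - 0 ^ 2)))) := by
      refine (H.g0.norm.pow 2).mul (Tendsto.mono_left ?_ nhdsWithin_le_nhds)
      have : ContinuousAt (fun r : ℝ => 2 - r ^ 2 / (1 - r ^ 2)) 0 := by
        refine continuousAt_const.sub (ContinuousAt.div (by fun_prop) (by fun_prop) (by norm_num))
      exact this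
    rw [norm_zero, zero_pow two_ne_zero, zero_mul] at h2
    refine h2.congr' ?_
    filter_upwards [Ioo_mem_nhdsGT (zero_lt_one)] with r hr
    have hr0 := hr.1
    rw [norm_mul, Complex.norm_real, Real.norm_of_nonneg hr0.le, mul_pow]
    field_simp
  · obtain ⟨B, hB0, hB⟩ := H.lip
    have h2 : Tendsto (fun r : ℝ => B ^ 2 * (1 - r) * (2 / r ^ 2 + 1))
        (nhdsWithin 1 (Set.Iio 1)) (nhds (B ^ 2 * (1 - 1) * (2 / 1 ^ 2 + 1))) := by
      refine Tendsto.mono_left ?_ nhdsWithin_le_nhds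
      have : ContinuousAt (fun r : ℝ => B ^ 2 * (1 - r) * (2 / r ^ 2 + 1)) 1 := by
        refine ContinuousAt.mul (by fun_prop) (ContinuousAt.add (ContinuousAt.div (by fun_prop) (by fun_prop) (by norm_num)) (by fun_prop))
      exact this
    rw [sub_self, mul_zero, zero_mul] at h2
    refine squeeze_zero_norm' ?_ h2
    filter_upwards [Ioo_mem_nhdsLT (zero_lt_one)] with r hr
    have hr0 := hr.1
    have hr1 := hr.2
    have h1 : 0 < 1 - r ^ 2 := by nlinarith [hr.2]
    have h3 := hB r hr
    have hp : 0 < 1 - r := by linarith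
    have h4 : ‖(r : ℂ) * g r‖ ^ 2 ≤ (B * (1 - r)) ^ 2 := by
      rw [norm_mul, Complex.norm_real, Real.norm_of_nonneg hr0.le]
      have : r * ‖g r‖ ≤ B * (1 - r) := by nlinarith [norm_nonneg (g r)]
      gcongr
    have h5 : ‖(2 / r ^ 2 - 1 / (1 - r ^ 2))‖ ≤ 2 / r ^ 2 + 1 / (1 - r) := by
      refine (norm_sub_le _ _).trans ?_
      rw [Real.norm_of_nonneg (by positivity), Real.norm_of_nonneg (by positivity)]
      gcongr
      nlinarith
    rw [norm_mul, Real.norm_of_nonneg (by positivity)]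
    calc _ ≤ (B * (1 - r)) ^ 2 * (2 / r ^ 2 + 1 / (1 - r)) := by gcongr
      _ = B ^ 2 * (1 - r) * ((1 - r) * (2 / r ^ 2) + 1) := by field_simp
      _ ≤ B ^ 2 * (1 - r) * (1 * (2 / r ^ 2) + 1) := by gcongr; linarith
      _ = _ := by ring

lemma Rad.ibp_re {a A a2 b B b2 : ℝ → ℂ} (ha : Rad a A a2) (hb : Rad b B b2) :
    IntegrableOn (fun r => r * (a2 r * (starRingEnd ℂ) (b r)).re) (Set.Ioo 0 1) ∧
    IntegrableOn (fun r => (A r * (starRingEnd ℂ) (B r)).re / r) (Set.Ioo 0 1) ∧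
    ∫ r in Set.Ioo (0 : ℝ) 1, r * (a2 r * (starRingEnd ℂ) (b r)).re =
      - ∫ r in Set.Ioo (0 : ℝ) 1, (A r * (starRingEnd ℂ) (B r)).re / r := by
  obtain ⟨i1, i2⟩ := ha.ibp_int hb
  have key := congrArg Complex.reCLM (ha.ibp hb)
  rw [map_neg, ← Complex.reCLM.integral_comp_comm i1, ← Complex.reCLM.integral_comp_comm i2] at key
  have j1 := Complex.reCLM.integrable_comp i1
  have j2 := Complex.reCLM.integrable_comp i2
  have e1 : ∀ r : ℝ, Complex.reCLM ((r : ℂ) * a2 r * (starRingEnd ℂ) (b r)) =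
      r * (a2 r * (starRingEnd ℂ) (b r)).re := fun r => by
    rw [mul_assoc]; exact Complex.re_ofReal_mul _ _
  have e2 : ∀ r : ℝ, Complex.reCLM ((r : ℂ)⁻¹ * A r * (starRingEnd ℂ) (B r)) =
      (A r * (starRingEnd ℂ) (B r)).re / r := fun r => by
    rw [mul_assoc, ← Complex.ofReal_inv, div_eq_inv_mul]; exact Complex.re_ofReal_mul _ _
  simp only [e1, e2] at key j1 j2
  exact ⟨j1, j2, key⟩

lemma Rad.ibp_im {a A a2 : ℝ → ℂ} (ha : Rad a A a2) :
    IntegrableOn (fun r => r * (a2 r * (starRingEnd ℂ) (a r)).im) (Set.Ioo 0 1) ∧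
    ∫ r in Set.Ioo (0 : ℝ) 1, r * (a2 r * (starRingEnd ℂ) (a r)).im = 0 := by
  obtain ⟨i1, i2⟩ := ha.ibp_int ha
  have key := congrArg Complex.imCLM (ha.ibp ha)
  rw [map_neg, ← Complex.imCLM.integral_comp_comm i1, ← Complex.imCLM.integral_comp_comm i2] at key
  have j1 := Complex.imCLM.integrable_comp i1
  have e1 : ∀ r : ℝ, Complex.imCLM ((r : ℂ) * a2 r * (starRingEnd ℂ) (a r)) =
      r * (a2 r * (starRingEnd ℂ) (a r)).im := fun r => by
    rw [mul_assoc]; exact Complex.im_ofReal_mul _ _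
  have e2 : ∀ r : ℝ, Complex.imCLM ((r : ℂ)⁻¹ * A r * (starRingEnd ℂ) (A r)) = 0 := fun r => by
    rw [mul_assoc, ← Complex.ofReal_inv, Complex.mul_conj, ← Complex.ofReal_mul]
    exact Complex.ofReal_im (r⁻¹ * Complex.normSq (A r))
  simp only [e1, e2] at key j1
  exact ⟨j1, by simpa using key⟩

lemma re_mul_conj_self (z : ℂ) : (z * (starRingEnd ℂ) z).re = ‖z‖ ^ 2 := by
  rw [Complex.mul_conj, Complex.ofReal_re, Complex.normSq_eq_norm_sq]

lemma re_mul_conj_sq (z w : ℂ) : (z * (starRingEnd ℂ) w).re ^ 2 ≤ ‖z‖ ^ 2 * ‖w‖ ^ 2 := by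
  have h := Complex.abs_re_le_norm (z * (starRingEnd ℂ) w)
  rw [norm_mul, RCLike.norm_conj] at h
  rw [← mul_pow, ← sq_abs]
  gcongr

lemma norm_sub_ofReal_mul_sq (z w : ℂ) (c : ℝ) :
    ‖z - (c : ℂ) * w‖ ^ 2 = ‖z‖ ^ 2 - 2 * c * (z * (starRingEnd ℂ) w).re + c ^ 2 * ‖w‖ ^ 2 := by
  simp only [← Complex.normSq_eq_norm_sq, Complex.normSq_apply]
  simp
  ring

/-- `‖w - cψ‖²` expansion. -/
lemma Rad.expand0 {ψ G w : ℝ → ℂ} (h1 : Rad ψ G w) (c : ℝ) :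
    ∫ r in Set.Ioo (0 : ℝ) 1, ‖w r - (c : ℂ) * ψ r‖ ^ 2 * r =
      (∫ r in Set.Ioo (0 : ℝ) 1, ‖w r‖ ^ 2 * r)
      + 2 * c * (∫ r in Set.Ioo (0 : ℝ) 1, ‖G r‖ ^ 2 / r)
      + c ^ 2 * (∫ r in Set.Ioo (0 : ℝ) 1, ‖ψ r‖ ^ 2 * r) := by
  obtain ⟨i1, _, e⟩ := h1.ibp_re h1
  simp only [re_mul_conj_self] at e
  have : ∀ r : ℝ, ‖w r - (c : ℂ) * ψ r‖ ^ 2 * r = ‖w r‖ ^ 2 * r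
      + (-(2 * c)) * (r * (w r * (starRingEnd ℂ) (ψ r)).re) + c ^ 2 * (‖ψ r‖ ^ 2 * r) := fun r => by
    rw [norm_sub_ofReal_mul_sq]; ring
  simp only [this]
  rw [integral_add (intAdd h1.ih (intMul i1 _)) (intMul h1.ig _),
    integral_add h1.ih (intMul i1 _), integral_const_mul, integral_const_mul, e]
  ring

lemma Rad.expand1 {ψ G w K v : ℝ → ℂ} (h1 : Rad ψ G w) (h2 : Rad w K v) (c : ℝ) :
    ∫ r in Set.Ioo (0 : ℝ) 1, ‖K r - (c : ℂ) * G r‖ ^ 2 / r =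
      (∫ r in Set.Ioo (0 : ℝ) 1, ‖K r‖ ^ 2 / r)
      + 2 * c * (∫ r in Set.Ioo (0 : ℝ) 1, ‖w r‖ ^ 2 * r)
      + c ^ 2 * (∫ r in Set.Ioo (0 : ℝ) 1, ‖G r‖ ^ 2 / r) := by
  obtain ⟨i1, i2, e⟩ := h1.ibp_re h2
  simp only [re_mul_conj_self] at e
  have hsymm : ∀ r, (K r * (starRingEnd ℂ) (G r)).re = (G r * (starRingEnd ℂ) (K r)).re := by
    intro r; simp; ring
  have : ∀ r : ℝ, ‖K r - (c : ℂ) * G r‖ ^ 2 / r = ‖K r‖ ^ 2 / r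
      + (-(2 * c)) * ((G r * (starRingEnd ℂ) (K r)).re / r) + c ^ 2 * (‖G r‖ ^ 2 / r) := fun r => by
    rw [norm_sub_ofReal_mul_sq, hsymm]; ring
  simp only [this]
  rw [integral_add (intAdd h2.iG (intMul i2 _)) (intMul h1.iG _),
    integral_add h2.iG (intMul i2 _), integral_const_mul, integral_const_mul]
  have e' : ∫ r in Set.Ioo (0 : ℝ) 1, (G r * (starRingEnd ℂ) (K r)).re / r =
     - ∫ r in Set.Ioo (0 : ℝ) 1, ‖w r‖ ^ 2 * r := by
    rw [← neg_eq_iff_eq_neg, ← e]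
    simp only [mul_comm]
  rw [e']
  ring

lemma int_nonneg {f : ℝ → ℝ} (h : ∀ r ∈ Set.Ioo (0 : ℝ) 1, 0 ≤ f r) :
    0 ≤ ∫ r in Set.Ioo (0 : ℝ) 1, f r := setIntegral_nonneg measurableSet_Ioo h

/-- Poincaré. -/
lemma Rad.poincare {g G h : ℝ → ℂ} (H : Rad g G h) :
    ∫ r in Set.Ioo (0 : ℝ) 1, ‖g r‖ ^ 2 * r ≤ ∫ r in Set.Ioo (0 : ℝ) 1, ‖G r‖ ^ 2 / r := by
  refine (setIntegral_mono_on H.ig H.iH measurableSet_Ioo fun r hr => ?_).trans H.hardy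
  have hr0 := hr.1
  have h1 : 0 < 1 - r ^ 2 := by nlinarith [hr.2]
  rw [le_div_iff₀ (by positivity)]
  have : (1 - r ^ 2) ^ 2 ≤ 1 := by nlinarith [sq_nonneg r]
  exact mul_le_of_le_one_right (by positivity) this

/-- Trace estimate. -/
lemma Rad.trace {ψ G w : ℝ → ℂ} (H : Rad ψ G w)
    (hG0 : Tendsto G (nhdsWithin 0 (Set.Ioi 0)) (nhds 0)) {g1 : ℂ}
    (hG1 : Tendsto G (nhdsWithin 1 (Set.Iio 1)) (nhds g1)) :
    ‖g1‖ ^ 4 ≤ 16 * (∫ r in Set.Ioo (0 : ℝ) 1, ‖w r‖ ^ 2 * r) *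
      (∫ r in Set.Ioo (0 : ℝ) 1, ‖G r‖ ^ 2 / r) := by
  have hW0 : 0 ≤ ∫ r in Set.Ioo (0 : ℝ) 1, ‖w r‖ ^ 2 * r :=
    int_nonneg fun r hr => by have := hr.1; positivity
  have hE0 : 0 ≤ ∫ r in Set.Ioo (0 : ℝ) 1, ‖G r‖ ^ 2 / r :=
    int_nonneg fun r hr => by have := hr.1; positivity
  have hS1 : IntegrableOn (fun r => r * (w r * (starRingEnd ℂ) (G r)).re) (Set.Ioo 0 1) := by
    refine intOn_of_le (g := fun r => ‖w r‖ ^ 2 * r + ‖G r‖ ^ 2 / r) ?_ (intAdd H.ih H.iG) ?_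
    · exact continuousOn_id.mul (Complex.continuous_re.comp_continuousOn
        (H.ch.mul (Complex.continuous_conj.comp_continuousOn H.cG)))
    · intro r hr
      have hr0 := hr.1
      have hr1 := hr.2
      have h := Complex.abs_re_le_norm (w r * (starRingEnd ℂ) (G r))
      rw [norm_mul, RCLike.norm_conj] at h
      rw [norm_mul, Real.norm_of_nonneg hr0.le, Real.norm_eq_abs]
      have h3 : ‖G r‖ ^ 2 * r ≤ ‖G r‖ ^ 2 / r := by
        rw [le_div_iff₀ hr0, mul_assoc]
        exact mul_le_of_le_one_right (by positivity) (by nlinarith)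
      have h4 : r * |(w r * (starRingEnd ℂ) (G r)).re| ≤ r * (‖w r‖ * ‖G r‖) := by gcongr
      nlinarith [mul_nonneg hr0.le (sq_nonneg (‖w r‖ - ‖G r‖)),
        mul_nonneg hr0.le (sq_nonneg (‖w r‖ + ‖G r‖))]
  have hS2 := cs_ineq H.ih H.iG hS1 (fun r hr => by have := hr.1; positivity)
    (fun r hr => by have := hr.1; positivity) (by
      intro r hr
      have hr0 := hr.1
      have hr1 := hr.2
      have h3 : r ^ 2 ≤ 1 := by nlinarith
      calc (r * (w r * (starRingEnd ℂ) (G r)).re) ^ 2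
          = r ^ 2 * (w r * (starRingEnd ℂ) (G r)).re ^ 2 := by ring
        _ ≤ 1 * (‖w r‖ ^ 2 * ‖G r‖ ^ 2) := by
            gcongr; exact re_mul_conj_sq _ _
        _ = _ := by field_simp)
  obtain ⟨i1, _, e⟩ := H.ibp_re H
  simp only [re_mul_conj_self] at e
  have hE2 := cs_ineq H.ih H.ig i1 (fun r hr => by have := hr.1; positivity)
    (fun r hr => by have := hr.1; positivity) (by
      intro r hr
      calc (r * (w r * (starRingEnd ℂ) (ψ r)).re) ^ 2
          = r ^ 2 * (w r * (starRingEnd ℂ) (ψ r)).re ^ 2 := by ring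
        _ ≤ r ^ 2 * (‖w r‖ ^ 2 * ‖ψ r‖ ^ 2) := by
            gcongr; exact re_mul_conj_sq _ _
        _ = _ := by ring)
  rw [e, neg_sq] at hE2
  have hP := H.poincare
  have key := ftc_le (F := fun r => ‖G r‖ ^ 2)
    (F' := fun r => 2 * (‖G r‖ ^ 2 / r) + 2 * (r * (w r * (starRingEnd ℂ) (G r)).re))
    (Q := fun r => 2 * (‖G r‖ ^ 2 / r) + 2 * (r * (w r * (starRingEnd ℂ) (G r)).re))
    (a := ‖(0 : ℂ)‖ ^ 2) (b := ‖g1‖ ^ 2) ?_ (intAdd (intMul H.iG _) (intMul hS1 _))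
    (fun r _ => le_rfl) (hG0.norm.pow 2) (hG1.norm.pow 2)
  · rw [integral_add (intMul H.iG _) (intMul hS1 _), integral_const_mul, integral_const_mul,
      norm_zero] at key
    generalize (∫ r in Set.Ioo (0 : ℝ) 1, ‖w r‖ ^ 2 * r) = W at *
    generalize (∫ r in Set.Ioo (0 : ℝ) 1, ‖G r‖ ^ 2 / r) = E at *
    generalize (∫ r in Set.Ioo (0 : ℝ) 1, ‖ψ r‖ ^ 2 * r) = P at *
    generalize (∫ r in Set.Ioo (0 : ℝ) 1, r * (w r * (starRingEnd ℂ) (G r)).re) = S at *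
    have k1 : ‖g1‖ ^ 2 ≤ 2 * E + 2 * S := by linarith
    have k2 : E ^ 2 ≤ W * E := hE2.trans (by gcongr)
    have k3 : (‖g1‖ ^ 2) ^ 2 ≤ (2 * E + 2 * S) ^ 2 := by gcongr
    nlinarith [sq_nonneg (E - S)]
  · intro r hr
    have hr0 := hr.1
    have hr' : (r : ℂ) ≠ 0 := by exact_mod_cast hr0.ne'
    have hd : HasDerivAt G (G r / r + r * w r) r := by
      have h1 := (HasDerivAt.ofReal_comp (hasDerivAt_id r)).mul (H.d2 r hr)
      have h2 := h1.congr_of_eventuallyEq (f₁ := G) (by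
        filter_upwards [isOpen_Ioo.mem_nhds hr] with s hs
        have : (s : ℂ) ≠ 0 := by exact_mod_cast hs.1.ne'
        simp only [Pi.mul_apply, id]
        field_simp)
      refine h2.congr_deriv ?_
      simp only [id]
      push_cast
      field_simp
    refine hd.norm_sq.congr_deriv ?_
    rw [Complex.inner]
    rw [← re_mul_conj_self]
    have : (G r / r + r * w r) * (starRingEnd ℂ) (G r) =
       (r⁻¹ : ℝ) * (G r * (starRingEnd ℂ) (G r)) + r * (w r * (starRingEnd ℂ) (G r)) := by
      push_cast; ring
    rw [this, Complex.add_re, Complex.re_ofReal_mul, Complex.re_ofReal_mul]; ring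

/-- The algebraic part. -/
lemma core_alg {N d ν E Ps W Kk Q P X T Y Z Z2 γ : ℝ} (hd : 0 < d)
    (hNd : N * d ^ 3 = 1)
    (x0 : P = W + 2 * ν ^ 2 * E + (ν ^ 2) ^ 2 * Ps)
    (x1 : Y = Kk + 2 * ν ^ 2 * W + (ν ^ 2) ^ 2 * E)
    (htr : γ ^ 4 ≤ 16 * W * E) (hψH : Z2 ≤ E) (hH : Z ≤ Y)
    (r1 : ν ^ 2 * P + Y ≤ T) (r2 : N / 10 * X ≤ T) (r3 : P ≤ d⁻¹ * X + d ^ 2 * Z)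
    (cS : (E + ν ^ 2 * Ps) ^ 2 ≤ X * Z2) (cT : T ^ 2 ≤ P * Q)
    (pX : 0 ≤ X) (pP : 0 ≤ P) (pT : 0 ≤ T) (pE : 0 ≤ E) (pPs : 0 ≤ Ps) (pW : 0 ≤ W)
    (pQ : 0 ≤ Q) :
    0 ≤ Q ∧
    E + ν ^ 2 * Ps ≤ 121 * d ^ 5 * Q ∧
    W + ν ^ 2 * E + ν ^ 4 * Ps ≤ 121 * d ^ 4 * Q ∧
    Kk + ν ^ 2 * W + ν ^ 4 * E + ν ^ 6 * Ps ≤ 121 * d ^ 2 * Q ∧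
    γ ^ 4 ≤ 121 ^ 4 * d ^ 9 * Q ^ 2 := by
  have k0 : X ≤ 10 * d ^ 3 * T := by
    have := mul_le_mul_of_nonneg_left r2 (show 0 ≤ 10 * d ^ 3 by positivity)
    calc X = (N * d ^ 3) * X := by rw [hNd, one_mul]
      _ = 10 * d ^ 3 * (N / 10 * X) := by ring
      _ ≤ _ := this
  have k1 : Y ≤ T := by linarith [mul_nonneg (sq_nonneg ν) pP]
  have k2 : P ≤ 11 * d ^ 2 * T := by
    have q1 : d⁻¹ * X ≤ d⁻¹ * (10 * d ^ 3 * T) := by gcongr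
    have q2 : d⁻¹ * (10 * d ^ 3 * T) = 10 * d ^ 2 * T := by field_simp
    have q3 : d ^ 2 * Z ≤ d ^ 2 * T := by gcongr; linarith
    linarith
  have k3 : P ≤ 121 * d ^ 4 * Q := by
    rcases pP.eq_or_lt with hp | hp
    · rw [← hp]; positivity
    · have q : P * P ≤ P * (121 * d ^ 4 * Q) := by
        calc P * P ≤ (11 * d ^ 2 * T) * (11 * d ^ 2 * T) := by gcongr
          _ = 121 * d ^ 4 * T ^ 2 := by ring
          _ ≤ 121 * d ^ 4 * (P * Q) := by gcongr
          _ = _ := by ring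
      exact le_of_mul_le_mul_left q hp
  have k4 : T ≤ 11 * d ^ 2 * Q := by
    refine le_of_sq_le_sq ?_ (by positivity)
    calc T ^ 2 ≤ P * Q := cT
      _ ≤ 121 * d ^ 4 * Q * Q := by gcongr
      _ = _ := by ring
  have k5 : E + ν ^ 2 * Ps ≤ X := by
    have q0 : 0 ≤ ν ^ 2 * Ps := by positivity
    have q : (E + ν ^ 2 * Ps) ^ 2 ≤ X * (E + ν ^ 2 * Ps) :=
      cS.trans (by gcongr; linarith)
    rcases (add_nonneg pE q0).eq_or_lt with hp | hp
    · rw [← hp]; exact pX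
    · rw [sq] at q
      exact le_of_mul_le_mul_right q hp
  have k6 : E + ν ^ 2 * Ps ≤ 110 * d ^ 5 * Q := by
    calc E + ν ^ 2 * Ps ≤ 10 * d ^ 3 * T := k5.trans k0
      _ ≤ 10 * d ^ 3 * (11 * d ^ 2 * Q) := by gcongr
      _ = _ := by ring
  have k7 : W + ν ^ 2 * E + ν ^ 4 * Ps ≤ 121 * d ^ 4 * Q := by
    have : 0 ≤ ν ^ 2 * E := by positivity
    linarith
  refine ⟨pQ, ?_, k7, ?_, ?_⟩
  · have : 0 ≤ d ^ 5 * Q := by positivity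
    linarith
  · have u1 : 0 ≤ ν ^ 2 * W := by positivity
    have u2 : 0 ≤ ν ^ 4 * E := by positivity
    have u3 : 0 ≤ d ^ 2 * Q := by positivity
    rw [x0, x1] at r1
    linarith
  · have u1 : W ≤ 121 * d ^ 4 * Q := by
      have : 0 ≤ ν ^ 2 * E := by positivity
      have : 0 ≤ ν ^ 4 * Ps := by positivity
      linarith
    have u2 : E ≤ 110 * d ^ 5 * Q := by
      have : 0 ≤ ν ^ 2 * Ps := by positivity
      linarith
    have u3 : 0 ≤ d ^ 9 * Q ^ 2 := by positivity
    calc γ ^ 4 ≤ 16 * W * E := htr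
      _ ≤ 16 * (121 * d ^ 4 * Q) * (110 * d ^ 5 * Q) := by gcongr
      _ = 212960 * (d ^ 9 * Q ^ 2) := by ring
      _ ≤ 121 ^ 4 * (d ^ 9 * Q ^ 2) := by gcongr; norm_num
      _ = _ := by ring

set_option maxHeartbeats 1000000 in
/-- The real-valued core of the estimates. -/
lemma core {N d ν : ℝ} {V : ℝ → ℝ} {ψ G w K v f : ℝ → ℂ} (hd : 0 < d)
    (hNd : N * d ^ 3 = 1) (h1 : Rad ψ G w) (h2 : Rad w K v)
    (hV : ∀ r ∈ Set.Ioo (0 : ℝ) 1, N / 10 * (1 - r ^ 2) ≤ |ν| * V r)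
    (hfc : ContinuousOn f (Set.Ioo 0 1))
    (hfi : IntegrableOn (fun r => ‖f r‖ ^ 2 * r) (Set.Ioo 0 1))
    (heq : ∀ r ∈ Set.Ioo (0 : ℝ) 1, Complex.I * (ν : ℂ) * (V r : ℂ) * (w r - ((ν ^ 2 : ℝ) : ℂ) * ψ r)
      - ((v r - ((ν ^ 2 : ℝ) : ℂ) * w r) - ((ν ^ 2 : ℝ) : ℂ) * (w r - ((ν ^ 2 : ℝ) : ℂ) * ψ r)) = f r)
    (hG0 : Tendsto G (nhdsWithin 0 (Set.Ioi 0)) (nhds 0)) {g1 : ℂ}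
    (hG1 : Tendsto G (nhdsWithin 1 (Set.Iio 1)) (nhds g1))
    {E Ps W Kk Q : ℝ}
    (hE : ∫ r in Set.Ioo (0 : ℝ) 1, ‖G r‖ ^ 2 / r = E)
    (hPs : ∫ r in Set.Ioo (0 : ℝ) 1, ‖ψ r‖ ^ 2 * r = Ps)
    (hW : ∫ r in Set.Ioo (0 : ℝ) 1, ‖w r‖ ^ 2 * r = W)
    (hKk : ∫ r in Set.Ioo (0 : ℝ) 1, ‖K r‖ ^ 2 / r = Kk)
    (hQ : ∫ r in Set.Ioo (0 : ℝ) 1, ‖f r‖ ^ 2 * r = Q) :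
    0 ≤ Q ∧
    E + ν ^ 2 * Ps ≤ 121 * d ^ 5 * Q ∧
    W + ν ^ 2 * E + ν ^ 4 * Ps ≤ 121 * d ^ 4 * Q ∧
    Kk + ν ^ 2 * W + ν ^ 4 * E + ν ^ 6 * Ps ≤ 121 * d ^ 2 * Q ∧
    ‖g1‖ ^ 4 ≤ 121 ^ 4 * d ^ 9 * Q ^ 2 := by
  have hφ := h2.comb h1 ((ν ^ 2 : ℝ) : ℂ)
  have x0 := h1.expand0 (ν ^ 2)
  have x1 := h1.expand1 h2 (ν ^ 2)
  have htr := h1.trace hG0 hG1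
  obtain ⟨j1, _, e1⟩ := h1.ibp_re h1
  have hψH := h1.hardy
  have hψI := h1.iH
  rw [hE, hPs, hW] at x0
  rw [hE, hKk, hW] at x1
  rw [hE, hW] at htr
  rw [hE] at hψH
  simp only [re_mul_conj_self] at e1
  rw [hE] at e1
  have hpsi := h1.ig
  have hwre : ∀ r, (w r * (starRingEnd ℂ) (ψ r)).re = ((w r - ((ν ^ 2 : ℝ) : ℂ) * ψ r) * (starRingEnd ℂ) (ψ r)).re
      + ν ^ 2 * ‖ψ r‖ ^ 2 := by
    intro r
    rw [sub_mul, mul_assoc, Complex.sub_re, Complex.re_ofReal_mul, re_mul_conj_self]; ring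
  generalize hφe : (fun r => w r - ((ν ^ 2 : ℝ) : ℂ) * ψ r) = φ at *
  generalize hΓe : (fun r => K r - ((ν ^ 2 : ℝ) : ℂ) * G r) = Γ at *
  generalize hhe : (fun r => v r - ((ν ^ 2 : ℝ) : ℂ) * w r) = h at *
  have a1 : ∀ r, w r - ((ν ^ 2 : ℝ) : ℂ) * ψ r = φ r := fun r => congrFun hφe r
  have a2 : ∀ r, K r - ((ν ^ 2 : ℝ) : ℂ) * G r = Γ r := fun r => congrFun hΓe r
  have a3 : ∀ r, v r - ((ν ^ 2 : ℝ) : ℂ) * w r = h r := fun r => congrFun hhe r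
  simp only [a1, a2, a3] at x0 x1 heq hwre
  have hH := hφ.hardy
  obtain ⟨i1, _, e2⟩ := hφ.ibp_re hφ
  simp only [re_mul_conj_self] at e2
  obtain ⟨i2, e3⟩ := hφ.ibp_im
  have iP := hφ.ig
  have iX : IntegrableOn (fun r => (1 - r ^ 2) * (‖φ r‖ ^ 2 * r)) (Set.Ioo 0 1) := by
    refine intOn_of_le ?_ iP ?_
    · exact ContinuousOn.mul (by fun_prop) ((hφ.cg.norm.pow 2).mul continuousOn_id)
    · intro r hr
      have hr0 := hr.1
      have h1 : 0 < 1 - r ^ 2 := by nlinarith [hr.2]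
      rw [Real.norm_of_nonneg (by positivity)]
      exact mul_le_of_le_one_left (by positivity) (by nlinarith)
  have iT : IntegrableOn (fun r => ‖f r‖ * ‖φ r‖ * r) (Set.Ioo 0 1) := by
    refine intOn_of_le ((hfc.norm.mul hφ.cg.norm).mul continuousOn_id) (intAdd hfi iP) ?_
    intro r hr
    have hr0 := hr.1
    rw [Real.norm_of_nonneg (by positivity)]
    nlinarith [mul_nonneg hr0.le (sq_nonneg (‖f r‖ - ‖φ r‖)),
        mul_nonneg hr0.le (sq_nonneg (‖f r‖ + ‖φ r‖))]
  have cT := cs_ineq iP hfi iT (fun r hr => by have := hr.1; positivity)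
    (fun r hr => by have := hr.1; positivity) (fun r hr => le_of_eq (by ring))
  -- pointwise consequence of the equation
  have pt : ∀ r ∈ Set.Ioo (0 : ℝ) 1,
      ν ^ 2 * ‖φ r‖ ^ 2 - (h r * (starRingEnd ℂ) (φ r)).re = (f r * (starRingEnd ℂ) (φ r)).re ∧
      ν * V r * ‖φ r‖ ^ 2 - (h r * (starRingEnd ℂ) (φ r)).im = (f r * (starRingEnd ℂ) (φ r)).im := by
    intro r hr
    have e : f r * (starRingEnd ℂ) (φ r) = ((ν ^ 2 * ‖φ r‖ ^ 2 : ℝ) : ℂ) +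
       ((ν * V r * ‖φ r‖ ^ 2 : ℝ) : ℂ) * Complex.I - h r * (starRingEnd ℂ) (φ r) := by
      have := Complex.mul_conj (φ r)
      rw [Complex.normSq_eq_norm_sq] at this
      rw [← heq r hr]
      push_cast at this ⊢
      linear_combination (Complex.I * ν * V r + ν ^ 2) * this
    rw [e]
    constructor
    · rw [Complex.sub_re, Complex.add_re, Complex.re_ofReal_mul, Complex.ofReal_re, Complex.I_re]
      ring
    · rw [Complex.sub_im, Complex.add_im, Complex.im_ofReal_mul, Complex.ofReal_im, Complex.I_im]
      ring
  have bre : ∀ r, |(f r * (starRingEnd ℂ) (φ r)).re| ≤ ‖f r‖ * ‖φ r‖ := fun r => by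
    have := Complex.abs_re_le_norm (f r * (starRingEnd ℂ) (φ r))
    rwa [norm_mul, RCLike.norm_conj] at this
  have bim : ∀ r, |(f r * (starRingEnd ℂ) (φ r)).im| ≤ ‖f r‖ * ‖φ r‖ := fun r => by
    have := Complex.abs_im_le_norm (f r * (starRingEnd ℂ) (φ r))
    rwa [norm_mul, RCLike.norm_conj] at this
  have r1 : ν ^ 2 * (∫ r in Set.Ioo (0 : ℝ) 1, ‖φ r‖ ^ 2 * r)
      + (∫ r in Set.Ioo (0 : ℝ) 1, ‖Γ r‖ ^ 2 / r) ≤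
      ∫ r in Set.Ioo (0 : ℝ) 1, ‖f r‖ * ‖φ r‖ * r := by
    have := setIntegral_mono_on (intSub (intMul iP (ν ^ 2)) i1) iT measurableSet_Ioo (fun r hr => by
      have hr0 := hr.1
      have p := (pt r hr).1
      have q := (le_abs_self _).trans (bre r)
      rw [← p] at q
      nlinarith [mul_le_mul_of_nonneg_left q hr0.le])
    rw [integral_sub (intMul iP (ν ^ 2)) i1, integral_const_mul, e2] at this
    linarith
  have r2 : N / 10 * (∫ r in Set.Ioo (0 : ℝ) 1, (1 - r ^ 2) * (‖φ r‖ ^ 2 * r)) ≤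
      ∫ r in Set.Ioo (0 : ℝ) 1, ‖f r‖ * ‖φ r‖ * r := by
    obtain ⟨σ, hσ, hσν⟩ : ∃ σ : ℝ, |σ| = 1 ∧ σ * ν = |ν| := by
      rcases le_total 0 ν with h | h
      · exact ⟨1, by simp, by rw [abs_of_nonneg h, one_mul]⟩
      · exact ⟨-1, by simp, by rw [abs_of_nonpos h]; ring⟩
    have := setIntegral_mono_on (intSub (intMul iX (N / 10)) (intMul i2 σ)) iT measurableSet_Ioo
      (fun r hr => by
      have hr0 := hr.1
      have p := (pt r hr).2
      have q : σ * (f r * (starRingEnd ℂ) (φ r)).im ≤ ‖f r‖ * ‖φ r‖ := by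
        refine (le_abs_self _).trans ?_
        rw [abs_mul, hσ, one_mul]; exact bim r
      rw [← p] at q
      have q2 := mul_le_mul_of_nonneg_right (hV r hr) (show 0 ≤ ‖φ r‖ ^ 2 * r by positivity)
      have q3 := mul_le_mul_of_nonneg_right q hr0.le
      rw [← hσν] at q2
      linarith)
    rw [integral_sub (intMul iX _) (intMul i2 σ), integral_const_mul, integral_const_mul, e3] at this
    linarith
  have r3 : (∫ r in Set.Ioo (0 : ℝ) 1, ‖φ r‖ ^ 2 * r) ≤
      d⁻¹ * (∫ r in Set.Ioo (0 : ℝ) 1, (1 - r ^ 2) * (‖φ r‖ ^ 2 * r)) +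
      d ^ 2 * (∫ r in Set.Ioo (0 : ℝ) 1, ‖φ r‖ ^ 2 * r / (1 - r ^ 2) ^ 2) := by
    rw [← integral_const_mul, ← integral_const_mul, ← integral_add (intMul iX _) (intMul hφ.iH _)]
    refine setIntegral_mono_on iP (intAdd (intMul iX _) (intMul hφ.iH _)) measurableSet_Ioo ?_
    intro r hr
    have hr0 := hr.1
    have h1 : 0 < 1 - r ^ 2 := by nlinarith [hr.2]
    have q : 1 ≤ d⁻¹ * (1 - r ^ 2) + d ^ 2 / (1 - r ^ 2) ^ 2 := by
      rcases le_total d (1 - r ^ 2) with hh | hh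
      · have : 1 ≤ d⁻¹ * (1 - r ^ 2) := by rw [inv_mul_eq_div, le_div_iff₀ hd]; linarith
        have : 0 ≤ d ^ 2 / (1 - r ^ 2) ^ 2 := by positivity
        linarith
      · have : 1 ≤ d ^ 2 / (1 - r ^ 2) ^ 2 := by
          rw [le_div_iff₀ (by positivity), one_mul]; gcongr
        have : 0 ≤ d⁻¹ * (1 - r ^ 2) := by positivity
        linarith
    calc ‖φ r‖ ^ 2 * r = 1 * (‖φ r‖ ^ 2 * r) := by ring
      _ ≤ (d⁻¹ * (1 - r ^ 2) + d ^ 2 / (1 - r ^ 2) ^ 2) * (‖φ r‖ ^ 2 * r) := by gcongr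
      _ = _ := by ring
  have iS : IntegrableOn (fun r => r * (φ r * (starRingEnd ℂ) (ψ r)).re) (Set.Ioo 0 1) := by
    have := intSub j1 (intMul hpsi (ν ^ 2))
    refine this.congr_fun (fun r hr => ?_) measurableSet_Ioo
    simp only [hwre]; ring
  have eS : ∫ r in Set.Ioo (0 : ℝ) 1, r * (φ r * (starRingEnd ℂ) (ψ r)).re = -(E + ν ^ 2 * Ps) := by
    have : ∀ r : ℝ, r * (w r * (starRingEnd ℂ) (ψ r)).re =
      r * (φ r * (starRingEnd ℂ) (ψ r)).re + ν ^ 2 * (‖ψ r‖ ^ 2 * r) := fun r => by rw [hwre]; ring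
    simp only [this] at e1
    rw [integral_add iS (intMul hpsi _), integral_const_mul, hPs] at e1
    linarith
  have cS := cs_ineq iX hψI iS
    (fun r hr => by
      have := hr.1
      have h1 : 0 < 1 - r ^ 2 := by nlinarith [hr.2]
      positivity)
    (fun r hr => by
      have := hr.1
      have h1 : 0 < 1 - r ^ 2 := by nlinarith [hr.2]
      positivity) (by
      intro r hr
      have hr0 := hr.1
      have h1 : 0 < 1 - r ^ 2 := by nlinarith [hr.2]
      have h2 : 1 ≤ 1 / (1 - r ^ 2) := by rw [le_div_iff₀ h1]; nlinarith
      calc (r * (φ r * (starRingEnd ℂ) (ψ r)).re) ^ 2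
          = r ^ 2 * (φ r * (starRingEnd ℂ) (ψ r)).re ^ 2 := by ring
        _ ≤ r ^ 2 * (‖φ r‖ ^ 2 * ‖ψ r‖ ^ 2) * 1 := by
            rw [mul_one]; gcongr; exact re_mul_conj_sq _ _
        _ ≤ r ^ 2 * (‖φ r‖ ^ 2 * ‖ψ r‖ ^ 2) * (1 / (1 - r ^ 2)) := by gcongr
        _ = _ := by field_simp)
  rw [eS, neg_sq] at cS
  have pX : 0 ≤ ∫ r in Set.Ioo (0 : ℝ) 1, (1 - r ^ 2) * (‖φ r‖ ^ 2 * r) :=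
    int_nonneg fun r hr => by
      have := hr.1
      have h1 : 0 < 1 - r ^ 2 := by nlinarith [hr.2]
      positivity
  have pP : 0 ≤ ∫ r in Set.Ioo (0 : ℝ) 1, ‖φ r‖ ^ 2 * r :=
    int_nonneg fun r hr => by have := hr.1; positivity
  have pT : 0 ≤ ∫ r in Set.Ioo (0 : ℝ) 1, ‖f r‖ * ‖φ r‖ * r :=
    int_nonneg fun r hr => by have := hr.1; positivity
  have pY : 0 ≤ ∫ r in Set.Ioo (0 : ℝ) 1, ‖Γ r‖ ^ 2 / r :=
    int_nonneg fun r hr => by have := hr.1; positivity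
  have pE : 0 ≤ E := hE ▸ int_nonneg fun r hr => by have := hr.1; positivity
  have pPs : 0 ≤ Ps := hPs ▸ int_nonneg fun r hr => by have := hr.1; positivity
  have pW : 0 ≤ W := hW ▸ int_nonneg fun r hr => by have := hr.1; positivity
  have pQ : 0 ≤ Q := hQ ▸ int_nonneg fun r hr => by have := hr.1; positivity
  rw [hQ] at cT
  generalize (∫ r in Set.Ioo (0 : ℝ) 1, ‖φ r‖ ^ 2 * r) = P at *
  generalize (∫ r in Set.Ioo (0 : ℝ) 1, (1 - r ^ 2) * (‖φ r‖ ^ 2 * r)) = X at *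
  generalize (∫ r in Set.Ioo (0 : ℝ) 1, ‖f r‖ * ‖φ r‖ * r) = T at *
  generalize (∫ r in Set.Ioo (0 : ℝ) 1, ‖Γ r‖ ^ 2 / r) = Y at *
  generalize (∫ r in Set.Ioo (0 : ℝ) 1, ‖φ r‖ ^ 2 * r / (1 - r ^ 2) ^ 2) = Z at *
  generalize (∫ r in Set.Ioo (0 : ℝ) 1, ‖ψ r‖ ^ 2 * r / (1 - r ^ 2) ^ 2) = Z2 at *
  clear hφ hφe hΓe hhe a1 a2 a3 heq
  -- pure algebra from here on
  exact core_alg hd hNd x0 x1 htr hψH hH r1 r2 r3 cS cT pX pP pT pE pPs pW pQ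

lemma wInt_integrable {h : ℝ → ℝ} (hc : ContinuousOn h (Set.Ioo 0 1))
    (h0 : ∀ r ∈ Set.Ioo (0 : ℝ) 1, 0 ≤ h r) (hf : wInt h < ⊤) :
    IntegrableOn h (Set.Ioo 0 1) := by
  refine (lintegral_ofReal_ne_top_iff_integrable
    (hc.aestronglyMeasurable measurableSet_Ioo) ?_).1 hf.ne
  exact (ae_restrict_iff' measurableSet_Ioo).2 (Eventually.of_forall h0)

lemma wInt_eq {h : ℝ → ℝ} (hi : IntegrableOn h (Set.Ioo 0 1))
    (h0 : ∀ r ∈ Set.Ioo (0 : ℝ) 1, 0 ≤ h r) :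
    wInt h = ENNReal.ofReal (∫ r in Set.Ioo (0 : ℝ) 1, h r) := by
  rw [wInt, ofReal_integral_eq_lintegral_ofReal hi]
  exact (ae_restrict_iff' measurableSet_Ioo).2 (Eventually.of_forall h0)

lemma dz_contDiffOn {g : ℝ → ℂ} {m k : WithTop ℕ∞} (hg : ContDiffOn ℝ k g (Set.Ioc 0 1))
    (hm : m + 1 ≤ k) : ContDiffOn ℝ m (dz g) (Set.Ioc 0 1) :=
  hg.derivWithin (uniqueDiffOn_Ioc 0 1) hm

lemma dz_hasDerivWithinAt {g : ℝ → ℂ} (hg : ContDiffOn ℝ 1 g (Set.Ioc 0 1)) {r : ℝ}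
    (hr : r ∈ Set.Ioc (0 : ℝ) 1) : HasDerivWithinAt g (dz g r) (Set.Ioc 0 1) r :=
  ((hg.differentiableOn one_ne_zero) r hr).hasDerivWithinAt

lemma dz_eq {g : ℝ → ℂ} {g' : ℂ} {r : ℝ} (hr : r ∈ Set.Ioc (0 : ℝ) 1)
    (h : HasDerivWithinAt g g' (Set.Ioc 0 1) r) : dz g r = g' :=
  h.derivWithin (uniqueDiffOn_Ioc 0 1 r hr)

lemma ofReal_contDiffOn {k : WithTop ℕ∞} :
    ContDiffOn ℝ k (fun s : ℝ => (s : ℂ)) (Set.Ioc 0 1) :=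
  Complex.ofRealCLM.contDiff.contDiffOn

lemma ofReal_ne {r : ℝ} (hr : r ∈ Set.Ioc (0 : ℝ) 1) : (r : ℂ) ≠ 0 := by
  exact_mod_cast hr.1.ne'

lemma ofReal_inv_contDiffOn {k : WithTop ℕ∞} :
    ContDiffOn ℝ k (fun s : ℝ => (s : ℂ)⁻¹) (Set.Ioc 0 1) :=
  ofReal_contDiffOn.inv fun _ hr => ofReal_ne hr

lemma Lop_contDiffOn {g : ℝ → ℂ} {m k : WithTop ℕ∞} (hg : ContDiffOn ℝ k g (Set.Ioc 0 1))
    (hm : m + 1 + 1 ≤ k) : ContDiffOn ℝ m (Lop g) (Set.Ioc 0 1) := by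
  have h1 : ContDiffOn ℝ (m + 1) (dz g) (Set.Ioc 0 1) := dz_contDiffOn hg hm
  have h2 : ContDiffOn ℝ m (dz (dz g)) (Set.Ioc 0 1) := dz_contDiffOn h1 le_rfl
  have h3 : ContDiffOn ℝ m (dz g) (Set.Ioc 0 1) := h1.of_le le_self_add
  have h4 : ContDiffOn ℝ m g (Set.Ioc 0 1) := hg.of_le ((le_self_add.trans le_self_add).trans hm)
  exact (h2.add (ofReal_inv_contDiffOn.mul h3)).sub
    (((ofReal_contDiffOn.pow 2).inv fun _ hr => pow_ne_zero 2 (ofReal_ne hr)).mul h4)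

lemma ofReal_hdw (r : ℝ) : HasDerivWithinAt (fun s : ℝ => (s : ℂ)) 1 (Set.Ioc 0 1) r :=
  (HasDerivAt.ofReal_comp (hasDerivAt_id r)).hasDerivWithinAt

lemma dz_rg {g : ℝ → ℂ} (hg : ContDiffOn ℝ 1 g (Set.Ioc 0 1)) {r : ℝ}
    (hr : r ∈ Set.Ioc (0 : ℝ) 1) :
    HasDerivWithinAt (fun s : ℝ => (s : ℂ) * g s) (g r + r * dz g r) (Set.Ioc 0 1) r := by
  have := (ofReal_hdw r).mul (dz_hasDerivWithinAt hg hr)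
  rwa [one_mul] at this

lemma dz_rg_eq {g : ℝ → ℂ} (hg : ContDiffOn ℝ 1 g (Set.Ioc 0 1)) {r : ℝ}
    (hr : r ∈ Set.Ioc (0 : ℝ) 1) :
    dz (fun s : ℝ => (s : ℂ) * g s) r = g r + r * dz g r := dz_eq hr (dz_rg hg hr)

lemma rad_of {g : ℝ → ℂ} (hg : ContDiffOn ℝ 2 g (Set.Ioc 0 1))
    (g0 : Tendsto g (nhdsWithin (0 : ℝ) (Set.Ioc 0 1)) (nhds (0 : ℂ)))
    (G0 : ∃ L : ℂ, Tendsto (dz (fun r => (r : ℂ) * g r)) (nhdsWithin (0 : ℝ) (Set.Ioc 0 1)) (nhds L))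
    (g1 : g 1 = 0)
    (iG : wInt (fun r => ‖dz (fun s => (s : ℂ) * g s) r‖ ^ 2 / r) < ⊤)
    (ih : wInt (fun r => ‖Lop g r‖ ^ 2 * r) < ⊤) :
    Rad g (dz (fun s => (s : ℂ) * g s)) (Lop g) := by
  have hg1 : ContDiffOn ℝ 1 g (Set.Ioc 0 1) := hg.of_le (by norm_num)
  have hdg : ContDiffOn ℝ 1 (dz g) (Set.Ioc 0 1) := dz_contDiffOn hg (by norm_num)
  have hL : ContDiffOn ℝ 0 (Lop g) (Set.Ioc 0 1) := Lop_contDiffOn hg (by norm_num)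
  have hG : ContinuousOn (dz (fun s => (s : ℂ) * g s)) (Set.Ioc 0 1) :=
    (dz_contDiffOn (m := 0) (k := 1) (ofReal_contDiffOn.mul hg1) (by norm_num)).continuousOn
  have hsub : Set.Ioo (0 : ℝ) 1 ⊆ Set.Ioc 0 1 := Set.Ioo_subset_Ioc_self
  have h1m : (1 : ℝ) ∈ Set.Ioc (0 : ℝ) 1 := by simp
  have e0 : nhdsWithin (0 : ℝ) (Set.Ioc 0 1) = nhdsWithin 0 (Set.Ioi 0) :=
    nhdsWithin_Ioc_eq_nhdsGT zero_lt_one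
  have le1 : nhdsWithin (1 : ℝ) (Set.Iio 1) ≤ nhdsWithin 1 (Set.Ioc 0 1) := by
    rw [← nhdsWithin_Ioo_eq_nhdsLT (zero_lt_one : (0 : ℝ) < 1)]
    exact nhdsWithin_mono _ hsub
  have hmem : ∀ r ∈ Set.Ioo (0 : ℝ) 1, Set.Ioc (0 : ℝ) 1 ∈ nhds r := fun r hr =>
    Ioc_mem_nhds hr.1 hr.2
  refine ⟨fun r hr => ?_, fun r hr => ?_, hg.continuousOn.mono hsub, hG.mono hsub,
    hL.continuousOn.mono hsub, e0 ▸ g0, ?_, e0 ▸ G0, ⟨_, (hG 1 h1m).mono_left le1⟩, ?_, ?_⟩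
  · rw [dz_rg_eq hg1 (hsub hr)]
    exact (dz_rg hg1 (hsub hr)).hasDerivAt (hmem r hr)
  · have hr' := ofReal_ne (hsub hr)
    have a1 := (dz_hasDerivWithinAt hg1 (hsub hr)).hasDerivAt (hmem r hr)
    have a2 := (dz_hasDerivWithinAt hdg (hsub hr)).hasDerivAt (hmem r hr)
    have a3 := ((ofReal_hdw r).hasDerivAt (hmem r hr)).inv hr'
    have a4 := (a3.mul a1).add a2
    have a5 := a4.congr_of_eventuallyEq
      (f₁ := fun s : ℝ => (s : ℂ)⁻¹ * dz (fun s => (s : ℂ) * g s) s) (by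
      filter_upwards [hmem r hr] with s hs
      have := ofReal_ne hs
      rw [dz_rg_eq hg1 hs]
      simp only [Pi.add_apply, Pi.mul_apply, Pi.inv_apply]
      field_simp)
    refine a5.congr_deriv ?_
    simp only [Lop, Pi.inv_apply]
    field_simp
    ring
  · have := (hg.continuousOn 1 h1m).mono_left le1
    rwa [g1] at this
  · refine wInt_integrable ?_ (fun r hr => by have := hr.1; positivity) iG
    exact ((hG.mono hsub).norm.pow 2).div continuousOn_id (fun r hr => hr.1.ne')
  · refine wInt_integrable ?_ (fun r hr => by have := hr.1; positivity) ih
    exact ((hL.continuousOn.mono hsub).norm.pow 2).mul continuousOn_id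

lemma Lop_comb {a b : ℝ → ℂ} (ha : ContDiffOn ℝ 2 a (Set.Ioc 0 1))
    (hb : ContDiffOn ℝ 2 b (Set.Ioc 0 1)) (c : ℂ) {r : ℝ} (hr : r ∈ Set.Ioc (0 : ℝ) 1) :
    Lop (fun s => a s - c * b s) r = Lop a r - c * Lop b r := by
  have h1 : ∀ s ∈ Set.Ioc (0 : ℝ) 1, dz (fun s => a s - c * b s) s = dz a s - c * dz b s :=
    fun s hs => dz_eq hs ((dz_hasDerivWithinAt (ha.of_le (by norm_num)) hs).sub
      ((dz_hasDerivWithinAt (hb.of_le (by norm_num)) hs).const_mul c))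
  have ha' : ContDiffOn ℝ 1 (dz a) (Set.Ioc 0 1) := dz_contDiffOn ha (by norm_num)
  have hb' : ContDiffOn ℝ 1 (dz b) (Set.Ioc 0 1) := dz_contDiffOn hb (by norm_num)
  have h2 : dz (dz (fun s => a s - c * b s)) r = dz (dz a) r - c * dz (dz b) r := by
    refine dz_eq hr (HasDerivWithinAt.congr (f := fun s => dz a s - c * dz b s) ?_ h1 (h1 r hr))
    exact (dz_hasDerivWithinAt ha' hr).sub ((dz_hasDerivWithinAt hb' hr).const_mul c)
  simp only [Lop, h2, h1 r hr]
  ring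

lemma Ubar_lower {Φ α r : ℝ} (hΦ : 0 < Φ) (hα : 1 < α) (hr : r ∈ Set.Ioo (0 : ℝ) 1) :
    Φ / 10 * (1 - r ^ 2) ≤ Ubar Φ α r := by
  have hr0 := hr.1
  have h1 : 0 < 1 - r ^ 2 := by nlinarith [hr.2]
  have e : Ubar Φ α r = (4 + 2 * α * (1 - r ^ 2)) / (4 + α) * (Φ / Real.pi) := by
    unfold Ubar
    have : 4 + 2 * α ≠ 0 := by positivity
    have := Real.pi_ne_zero
    field_simp
    ring
  have a1 : 2 / 5 * (1 - r ^ 2) ≤ (4 + 2 * α * (1 - r ^ 2)) / (4 + α) := by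
    rw [le_div_iff₀ (by linarith)]
    nlinarith
  have a2 : Φ / 4 ≤ Φ / Real.pi := by
    have := Real.pi_le_four
    have := Real.pi_pos
    gcongr
  rw [e]
  calc Φ / 10 * (1 - r ^ 2) = 2 / 5 * (1 - r ^ 2) * (Φ / 4) := by ring
    _ ≤ _ := by gcongr

/-- Lemma 3.6 (propslip-large): refined a priori estimates for the slip problem when
the slip coefficient is large (`α > 1`), uniform in `Φ > 0`, `α`, `n ≠ 0` and `f`. -/
theorem slip_apriori_estimates_large_alpha :
    ∃ C : ℝ, 0 < C ∧ ∀ (Φ α : ℝ) (n : ℤ) (f ψ : ℝ → ℂ),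
      0 < Φ → 1 < α → n ≠ 0 →
      ContinuousOn f (Set.Ioo 0 1) → wInt (fun r => ‖f r‖ ^ 2 * r) < ⊤ →
      SlipSol Φ α n f ψ →
      (wInt (fun r => ‖dz (fun s => (s : ℂ) * ψ s) r‖ ^ 2 / r)
          + ENNReal.ofReal ((n : ℝ) ^ 2) * wInt (fun r => ‖ψ r‖ ^ 2 * r)
        ≤ ENNReal.ofReal (C * (Φ * |(n : ℝ)|) ^ (-(5 / 3) : ℝ))
            * wInt (fun r => ‖f r‖ ^ 2 * r)) ∧
      (wInt (fun r => ‖Lop ψ r‖ ^ 2 * r)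
          + ENNReal.ofReal ((n : ℝ) ^ 2)
              * wInt (fun r => ‖dz (fun s => (s : ℂ) * ψ s) r‖ ^ 2 / r)
          + ENNReal.ofReal ((n : ℝ) ^ 4) * wInt (fun r => ‖ψ r‖ ^ 2 * r)
        ≤ ENNReal.ofReal (C * (Φ * |(n : ℝ)|) ^ (-(4 / 3) : ℝ))
            * wInt (fun r => ‖f r‖ ^ 2 * r)) ∧
      (wInt (fun r => ‖dz (fun s => (s : ℂ) * Lop ψ s) r‖ ^ 2 / r)
          + ENNReal.ofReal ((n : ℝ) ^ 2) * wInt (fun r => ‖Lop ψ r‖ ^ 2 * r)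
          + ENNReal.ofReal ((n : ℝ) ^ 4)
              * wInt (fun r => ‖dz (fun s => (s : ℂ) * ψ s) r‖ ^ 2 / r)
          + ENNReal.ofReal ((n : ℝ) ^ 6) * wInt (fun r => ‖ψ r‖ ^ 2 * r)
        ≤ ENNReal.ofReal (C * (Φ * |(n : ℝ)|) ^ (-(2 / 3) : ℝ))
            * wInt (fun r => ‖f r‖ ^ 2 * r)) ∧
      (ENNReal.ofReal ‖dz ψ 1‖
        ≤ ENNReal.ofReal (C * (Φ * |(n : ℝ)|) ^ (-(3 / 4) : ℝ))
            * (wInt (fun r => ‖f r‖ ^ 2 * r)) ^ ((1 : ℝ) / 2)) := by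
  refine ⟨121, by norm_num, ?_⟩
  intro Φ α n f ψ hΦ hα hn hfc hfw H
  have hψ2 : ContDiffOn ℝ 2 ψ (Set.Ioc 0 1) := H.smooth.of_le (by norm_num)
  have hψ1 : ContDiffOn ℝ 1 ψ (Set.Ioc 0 1) := H.smooth.of_le (by norm_num)
  have hw2 : ContDiffOn ℝ 2 (Lop ψ) (Set.Ioc 0 1) := Lop_contDiffOn H.smooth (by norm_num)
  have h1m : (1 : ℝ) ∈ Set.Ioc (0 : ℝ) 1 := by simp
  have hGlim : Tendsto (dz (fun r => (r : ℂ) * ψ r)) (nhdsWithin (0 : ℝ) (Set.Ioc 0 1))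
      (nhds 0) := by
    obtain ⟨L, hL⟩ := H.ext_dpsi
    have h0 : Tendsto (fun r : ℝ => (r : ℂ)) (nhdsWithin (0 : ℝ) (Set.Ioc 0 1)) (nhds ((0 : ℝ) : ℂ)) :=
      (Complex.continuous_ofReal.tendsto 0).mono_left nhdsWithin_le_nhds
    have := H.ext_psi.add (h0.mul hL)
    rw [Complex.ofReal_zero, zero_mul, add_zero] at this
    refine this.congr' ?_
    filter_upwards [self_mem_nhdsWithin] with r hr
    exact (dz_rg_eq hψ1 hr).symm
  have R1 := rad_of hψ2 H.ext_psi ⟨0, hGlim⟩ H.bc_psi H.fin_dpsi H.fin_Lpsi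
  have R2 := rad_of hw2 H.ext_Lpsi H.ext_dLpsi H.bc_slip H.fin_dLpsi H.fin_LLpsi
  have hnR : (n : ℝ) ≠ 0 := by exact_mod_cast hn
  have hN : 0 < Φ * |(n : ℝ)| := mul_pos hΦ (abs_pos.2 hnR)
  have hfi : IntegrableOn (fun r => ‖f r‖ ^ 2 * r) (Set.Ioo 0 1) :=
    wInt_integrable ((hfc.norm.pow 2).mul continuousOn_id)
      (fun r hr => by have := hr.1; positivity) hfw
  have hG1 : Tendsto (dz (fun r => (r : ℂ) * ψ r)) (nhdsWithin 1 (Set.Iio 1)) (nhds (dz ψ 1)) := by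
    have hG : ContinuousOn (dz (fun s => (s : ℂ) * ψ s)) (Set.Ioc 0 1) :=
      (dz_contDiffOn (m := 0) (k := 1) (ofReal_contDiffOn.mul hψ1) (by norm_num)).continuousOn
    have e1 : dz (fun r => (r : ℂ) * ψ r) 1 = dz ψ 1 := by
      rw [dz_rg_eq hψ1 h1m, H.bc_psi]; simp
    rw [← e1, ← nhdsWithin_Ioo_eq_nhdsLT (zero_lt_one : (0 : ℝ) < 1)]
    exact (hG 1 h1m).mono_left (nhdsWithin_mono _ Set.Ioo_subset_Ioc_self)
  rw [nhdsWithin_Ioc_eq_nhdsGT (zero_lt_one : (0 : ℝ) < 1)] at hGlim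
  have hpw : ∀ (x : ℝ) (k : ℕ), x = (-(1 / 3)) * k →
      (Φ * |(n : ℝ)|) ^ x = ((Φ * |(n : ℝ)|) ^ (-(1 / 3) : ℝ)) ^ k := by
    intro x k hx
    rw [hx, Real.rpow_mul hN.le, Real.rpow_natCast]
  have hdpos : 0 < (Φ * |(n : ℝ)|) ^ (-(1 / 3) : ℝ) := Real.rpow_pos_of_pos hN _
  have hNd : (Φ * |(n : ℝ)|) * ((Φ * |(n : ℝ)|) ^ (-(1 / 3) : ℝ)) ^ 3 = 1 := by
    rw [← hpw (-1) 3 (by norm_num), Real.rpow_neg_one]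
    exact mul_inv_cancel₀ hN.ne'
  obtain ⟨pQ, c1, c2, c3, c4⟩ := core (ν := n) (V := Ubar Φ α) hdpos hNd R1 R2
    (by
      intro r hr
      have := mul_le_mul_of_nonneg_left (Ubar_lower hΦ hα hr) (abs_nonneg (n : ℝ))
      linarith)
    hfc hfi
    (by
      intro r hr
      have h := H.eqn r hr
      rw [Lop_comb hw2 hψ2 _ (Set.Ioo_subset_Ioc_self hr)] at h
      push_cast
      exact h)
    hGlim hG1 rfl rfl rfl rfl rfl
  have pE : 0 ≤ ∫ r in Set.Ioo (0 : ℝ) 1, ‖dz (fun s => (s : ℂ) * ψ s) r‖ ^ 2 / r :=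
    int_nonneg fun r hr => by have := hr.1; positivity
  have pPs : 0 ≤ ∫ r in Set.Ioo (0 : ℝ) 1, ‖ψ r‖ ^ 2 * r :=
    int_nonneg fun r hr => by have := hr.1; positivity
  have pW : 0 ≤ ∫ r in Set.Ioo (0 : ℝ) 1, ‖Lop ψ r‖ ^ 2 * r :=
    int_nonneg fun r hr => by have := hr.1; positivity
  have pK : 0 ≤ ∫ r in Set.Ioo (0 : ℝ) 1, ‖dz (fun s => (s : ℂ) * Lop ψ s) r‖ ^ 2 / r :=
    int_nonneg fun r hr => by have := hr.1; positivity
  rw [wInt_eq R1.iG (fun r hr => by have := hr.1; positivity),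
    wInt_eq R1.ig (fun r hr => by have := hr.1; positivity),
    wInt_eq R1.ih (fun r hr => by have := hr.1; positivity),
    wInt_eq R2.iG (fun r hr => by have := hr.1; positivity),
    wInt_eq hfi (fun r hr => by have := hr.1; positivity)]
  rw [hpw (-(5 / 3)) 5 (by norm_num), hpw (-(4 / 3)) 4 (by norm_num),
    hpw (-(2 / 3)) 2 (by norm_num)]
  have h34 : ((Φ * |(n : ℝ)|) ^ (-(3 / 4) : ℝ)) ^ 4 = ((Φ * |(n : ℝ)|) ^ (-(1 / 3) : ℝ)) ^ 9 := by
    rw [← hpw (-3) 9 (by norm_num), ← Real.rpow_natCast, ← Real.rpow_mul hN.le]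
    norm_num
  have h34p : 0 < (Φ * |(n : ℝ)|) ^ (-(3 / 4) : ℝ) := Real.rpow_pos_of_pos hN _
  generalize (∫ r in Set.Ioo (0 : ℝ) 1, ‖dz (fun s => (s : ℂ) * ψ s) r‖ ^ 2 / r) = E at *
  generalize (∫ r in Set.Ioo (0 : ℝ) 1, ‖ψ r‖ ^ 2 * r) = Ps at *
  generalize (∫ r in Set.Ioo (0 : ℝ) 1, ‖Lop ψ r‖ ^ 2 * r) = W at *
  generalize (∫ r in Set.Ioo (0 : ℝ) 1, ‖dz (fun s => (s : ℂ) * Lop ψ s) r‖ ^ 2 / r) = Kk at *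
  generalize (∫ r in Set.Ioo (0 : ℝ) 1, ‖f r‖ ^ 2 * r) = Q at *
  generalize (Φ * |(n : ℝ)|) ^ (-(1 / 3) : ℝ) = d at *
  generalize (Φ * |(n : ℝ)|) ^ (-(3 / 4) : ℝ) = d' at *
  refine ⟨?_, ?_, ?_, ?_⟩
  · rw [← ENNReal.ofReal_mul (by positivity), ← ENNReal.ofReal_mul (by positivity),
      ← ENNReal.ofReal_add (by positivity) (by positivity)]
    exact ENNReal.ofReal_le_ofReal c1
  · rw [← ENNReal.ofReal_mul (by positivity), ← ENNReal.ofReal_mul (by positivity),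
      ← ENNReal.ofReal_mul (by positivity),
      ← ENNReal.ofReal_add (by positivity) (by positivity),
      ← ENNReal.ofReal_add (by positivity) (by positivity)]
    exact ENNReal.ofReal_le_ofReal c2
  · rw [← ENNReal.ofReal_mul (by positivity), ← ENNReal.ofReal_mul (by positivity),
      ← ENNReal.ofReal_mul (by positivity), ← ENNReal.ofReal_mul (by positivity),
      ← ENNReal.ofReal_add (by positivity) (by positivity),
      ← ENNReal.ofReal_add (by positivity) (by positivity),
      ← ENNReal.ofReal_add (by positivity) (by positivity)]
    exact ENNReal.ofReal_le_ofReal c3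
  · rw [ENNReal.ofReal_rpow_of_nonneg pQ (by norm_num), ← ENNReal.ofReal_mul (by positivity),
      ← Real.sqrt_eq_rpow]
    refine ENNReal.ofReal_le_ofReal ?_
    refine le_of_pow_le_pow_left₀ (n := 4) (by norm_num) (by positivity) ?_
    calc ‖dz ψ 1‖ ^ 4 ≤ 121 ^ 4 * d ^ 9 * Q ^ 2 := c4
      _ = 121 ^ 4 * d' ^ 4 * (Real.sqrt Q ^ 2) ^ 2 := by rw [Real.sq_sqrt pQ, h34]
      _ = _ := by ring
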